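/- arXiv:0712.2234 — 2 statements merged into one kernel-verified Lean document; each statement's English description precedes it below -/
import Mathlib

section
/- Let d₁, d₂, k be complex numbers with d₁ + d₂ = k, and suppose that d₁², d₂², and k² are all real and all nonzero. Then d₁², d₂², and k² all have the same sign: either all three are positive or all three are negative. -/
/-- A complex number with nonzero real square is either real or purely imaginary. -/
theorem Complex.im_eq_zero_or_re_eq_zero_of_sq_im_eq_zero {z : ℂ} (h : (z ^ 2).im = 0)
    (hz : z ^ 2 ≠ 0) : (z.im = 0 ∧ z.re ≠ 0) ∨ (z.re = 0 ∧ z.im ≠ 0) := by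
  have hz0 : z ≠ 0 := fun h0 => hz (by simp [h0])
  have hmul : z.re * z.im = 0 := by
    rw [pow_two, Complex.mul_im] at h
    linarith
  rcases mul_eq_zero.mp hmul with hre | him
  · exact Or.inr ⟨hre, fun him => hz0 (Complex.ext hre him)⟩
  · exact Or.inl ⟨him, fun hre => hz0 (Complex.ext hre him)⟩

theorem Complex.sq_re_pos {z : ℂ} (him : z.im = 0) (hre : z.re ≠ 0) : 0 < (z ^ 2).re := by
  simpa [pow_two, him] using hre

theorem Complex.sq_re_neg {z : ℂ} (hre : z.re = 0) (him : z.im ≠ 0) : (z ^ 2).re < 0 := by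
  simpa [pow_two, hre] using him

/-- At any point of a Minkowski ellipse (`d₁ + d₂ = k`, with all squares real
and nonzero), the squared focal distances `d₁²`, `d₂²` and the constant `k²`
all have the same sign. -/
theorem minkowski_ellipse_squared_distances_same_sign
    (d₁ d₂ k : ℂ) (hsum : d₁ + d₂ = k)
    (h1 : (d₁ ^ 2).im = 0) (h2 : (d₂ ^ 2).im = 0) (hk : (k ^ 2).im = 0)
    (h1' : d₁ ^ 2 ≠ 0) (h2' : d₂ ^ 2 ≠ 0) (hk' : k ^ 2 ≠ 0) :
    (0 < (d₁ ^ 2).re ∧ 0 < (d₂ ^ 2).re ∧ 0 < (k ^ 2).re) ∨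
      ((d₁ ^ 2).re < 0 ∧ (d₂ ^ 2).re < 0 ∧ (k ^ 2).re < 0) := by
  have hre : d₁.re + d₂.re = k.re := by rw [← hsum, Complex.add_re]
  have him : d₁.im + d₂.im = k.im := by rw [← hsum, Complex.add_im]
  rcases Complex.im_eq_zero_or_re_eq_zero_of_sq_im_eq_zero h1 h1' with ⟨a, a'⟩ | ⟨a, a'⟩ <;>
  rcases Complex.im_eq_zero_or_re_eq_zero_of_sq_im_eq_zero h2 h2' with ⟨b, b'⟩ | ⟨b, b'⟩ <;>
  rcases Complex.im_eq_zero_or_re_eq_zero_of_sq_im_eq_zero hk hk' with ⟨c, c'⟩ | ⟨c, c'⟩ <;>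
  first
  | exact Or.inl ⟨Complex.sq_re_pos a a', Complex.sq_re_pos b b', Complex.sq_re_pos c c'⟩
  | exact Or.inr ⟨Complex.sq_re_neg a a', Complex.sq_re_neg b b', Complex.sq_re_neg c c'⟩
  | simp_all
end

section
/- Let d₁, d₂, k be complex numbers with d₁ − d₂ = k, and suppose that d₁², d₂², and k² are all real and all nonzero. Then d₁², d₂², and k² all have the same sign: either all three are positive or all three are negative. -/
/-- A complex number whose square is real and nonzero is either a nonzero real number, with
positive square, or a nonzero purely imaginary number, with negative square. -/
lemma Complex.real_or_imaginary_of_sq_im_eq_zero {z : ℂ} (him : (z ^ 2).im = 0)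
    (hz : z ^ 2 ≠ 0) :
    (z.im = 0 ∧ z.re ≠ 0 ∧ 0 < (z ^ 2).re) ∨ (z.re = 0 ∧ z.im ≠ 0 ∧ (z ^ 2).re < 0) := by
  have hz0 : z ≠ 0 := by
    rintro rfl
    simp at hz
  have hmul : z.re * z.im = 0 := by
    simp only [pow_two, Complex.mul_im] at him
    linarith
  have hre : (z ^ 2).re = z.re * z.re - z.im * z.im := by
    rw [pow_two, Complex.mul_re]
  rcases mul_eq_zero.mp hmul with h | h
  · have hne : z.im ≠ 0 := fun h' => hz0 (Complex.ext h h')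
    have hpos := mul_self_pos.mpr hne
    exact Or.inr ⟨h, hne, by rw [hre, h]; linarith⟩
  · have hne : z.re ≠ 0 := fun h' => hz0 (Complex.ext h' h)
    have hpos := mul_self_pos.mpr hne
    exact Or.inl ⟨h, hne, by rw [hre, h]; linarith⟩


/-- At any point of a Minkowski hyperbola (`d₁ - d₂ = k`, with all squares real
and nonzero), the squared focal distances `d₁²`, `d₂²` and the constant `k²`
all have the same sign. -/
theorem minkowski_hyperbola_squared_distances_same_sign
    (d₁ d₂ k : ℂ) (hdiff : d₁ - d₂ = k)
    (h1 : (d₁ ^ 2).im = 0) (h2 : (d₂ ^ 2).im = 0) (hk : (k ^ 2).im = 0)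
    (h1' : d₁ ^ 2 ≠ 0) (h2' : d₂ ^ 2 ≠ 0) (hk' : k ^ 2 ≠ 0) :
    (0 < (d₁ ^ 2).re ∧ 0 < (d₂ ^ 2).re ∧ 0 < (k ^ 2).re) ∨
      ((d₁ ^ 2).re < 0 ∧ (d₂ ^ 2).re < 0 ∧ (k ^ 2).re < 0) := by
  have hre : d₁.re - d₂.re = k.re := by rw [← hdiff, Complex.sub_re]
  have him : d₁.im - d₂.im = k.im := by rw [← hdiff, Complex.sub_im]
  rcases Complex.real_or_imaginary_of_sq_im_eq_zero h1 h1' with ⟨a, a', a''⟩ | ⟨a, a', a''⟩ <;>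
  rcases Complex.real_or_imaginary_of_sq_im_eq_zero h2 h2' with ⟨b, b', b''⟩ | ⟨b, b', b''⟩ <;>
  rcases Complex.real_or_imaginary_of_sq_im_eq_zero hk hk' with ⟨c, c', c''⟩ | ⟨c, c', c''⟩ <;>
  grind
end
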